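/- Let σ be the permutation of Fin 6 given by the 5-cycle (0 1 2 3 4), fixing 5. The number of monotone functions f : (Fin 6 → Bool) → Bool satisfying f(x ∘ σ) = f(x) for all x equals 64. In the paper's notation: |Fix((12345), D_6)| = 64. -/

import Mathlib

/-- The 5-cycle `(0 1 2 3 4)` on `Fin 6`, as a plain function. -/
def rot : Fin 6 → Fin 6 := ![1, 2, 3, 4, 0, 5]

/-- The number of true entries plus the number of cyclically adjacent pairs of true entries among
the first five coordinates. This separates the orbits of `rot` on `Fin 5 → Bool`, and takes the
values `0, 1, 2, 3, 4, 5, 7, 10`. -/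
def orbitWeight (x : Fin 6 → Bool) : ℕ :=
  (x 0).toNat + (x 1).toNat + (x 2).toNat + (x 3).toNat + (x 4).toNat +
    ((x 0 && x 1).toNat + (x 1 && x 2).toNat + (x 2 && x 3).toNat + (x 3 && x 4).toNat +
      (x 4 && x 0).toNat)

/-- The index of the orbit of the first five coordinates under rotation. -/
def orbitIndex (x : Fin 6 → Bool) : Fin 8 :=
  if orbitWeight x ≤ 5 then Fin.ofNat 8 (orbitWeight x) else if orbitWeight x ≤ 7 then 6 else 7

/-- A representative of the orbit with index `i`, with last coordinate `b`. -/
def orbitRep (i : Fin 8) (b : Bool) : Fin 6 → Bool :=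
  ![decide (1 ≤ i), decide (i = 3 ∨ 4 ≤ i), decide (i = 2 ∨ 5 ≤ i), decide (i = 4 ∨ 6 ≤ i),
    decide (i = 7), b]

/-- The order on orbits induced by the pointwise order: `2, 3` and `4, 5` are the only
incomparable pairs. -/
def OrbitLE (i j : Fin 8) : Prop :=
  i ≤ j ∧ ¬(i = 2 ∧ j = 3) ∧ ¬(i = 4 ∧ j = 5)

instance (i j : Fin 8) : Decidable (OrbitLE i j) := by
  unfold OrbitLE; infer_instance

/-- The monotone Boolean functions on the poset of orbits. -/
abbrev OrbitMonotone : Type :=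
  {u : Fin 8 → Bool // ∀ i j, OrbitLE i j → u i ≤ u j}

theorem orbitIndex_comp_rot : ∀ x, orbitIndex (x ∘ rot) = orbitIndex x := by
  decide +kernel

theorem orbitIndex_orbitRep : ∀ i b, orbitIndex (orbitRep i b) = i := by
  decide +kernel

theorem orbitLE_of_le : ∀ x y : Fin 6 → Bool, (∀ i, x i ≤ y i) →
    OrbitLE (orbitIndex x) (orbitIndex y) := by
  decide +kernel

theorem exists_orbitRep_eq : ∀ x : Fin 6 → Bool, ∃ k : Fin 5,
    orbitRep (orbitIndex x) (x 5) = x ∘ rot^[k] := by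
  decide +kernel

theorem exists_orbitRep_le : ∀ i j, OrbitLE i j → ∀ b, ∃ k : Fin 5,
    ∀ l, orbitRep i b l ≤ (orbitRep j b ∘ rot^[k]) l := by
  decide +kernel

theorem orbitRep_le : ∀ i l, orbitRep i false l ≤ orbitRep i true l := by
  decide +kernel

theorem card_orbitMonotone_pairs :
    Fintype.card {p : OrbitMonotone × OrbitMonotone // ∀ i, p.1.1 i ≤ p.2.1 i} = 64 := by
  decide +kernel

theorem apply_comp_iterate {α β γ : Type*} {f : (α → β) → γ} {τ : α → α}
    (h : ∀ x, f (x ∘ τ) = f x) (k : ℕ) (x : α → β) : f (x ∘ τ^[k]) = f x := by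
  induction k with
  | zero => rfl
  | succ k ih => rw [Function.iterate_succ, ← Function.comp_assoc, h, ih]

theorem apply_orbitRep {f : (Fin 6 → Bool) → Bool} (h : ∀ x, f (x ∘ rot) = f x)
    (x : Fin 6 → Bool) : f (orbitRep (orbitIndex x) (x 5)) = f x := by
  obtain ⟨k, hk⟩ := exists_orbitRep_eq x
  rw [hk, apply_comp_iterate h]

theorem apply_orbitRep_mono {f : (Fin 6 → Bool) → Bool} (hf : Monotone f)
    (h : ∀ x, f (x ∘ rot) = f x) (b : Bool) (i j : Fin 8) (hij : OrbitLE i j) :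
    f (orbitRep i b) ≤ f (orbitRep j b) := by
  obtain ⟨k, hk⟩ := exists_orbitRep_le i j hij b
  exact (hf hk).trans_eq (apply_comp_iterate h _ _)

/-- A monotone rotation-invariant function amounts to a pair `u ≤ v` of monotone functions on the
poset of orbits, its restrictions to the two values of the last coordinate. -/
def fixEquiv :
    {f : (Fin 6 → Bool) → Bool // Monotone f ∧ ∀ x, f (x ∘ rot) = f x} ≃
      {p : OrbitMonotone × OrbitMonotone // ∀ i, p.1.1 i ≤ p.2.1 i} where
  toFun f :=
    ⟨(⟨fun i => f.1 (orbitRep i false), apply_orbitRep_mono f.2.1 f.2.2 false⟩,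
      ⟨fun i => f.1 (orbitRep i true), apply_orbitRep_mono f.2.1 f.2.2 true⟩),
      fun i => f.2.1 (orbitRep_le i)⟩
  invFun p :=
    ⟨fun x => bif x 5 then p.1.2.1 (orbitIndex x) else p.1.1.1 (orbitIndex x), by
      obtain ⟨⟨⟨u, hu⟩, ⟨v, hv⟩⟩, huv⟩ := p
      refine ⟨fun x y hxy => ?_, fun x => ?_⟩
      · have hle := orbitLE_of_le x y hxy
        have h5 := hxy 5
        cases hx : x 5 <;> cases hy : y 5
        · simpa [hx, hy] using hu _ _ hle
        · simpa [hx, hy] using (hu _ _ hle).trans (huv _)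
        · exact absurd (hx ▸ hy ▸ h5) (by decide)
        · simpa [hx, hy] using hv _ _ hle
      · have h5 : (x ∘ rot) 5 = x 5 := rfl
        simp only [orbitIndex_comp_rot, h5]⟩
  left_inv f := by
    ext x
    have h := apply_orbitRep f.2.2 x
    cases hx : x 5 <;> rw [hx] at h <;> simp [hx, h]
  right_inv p := by
    have h5 (i : Fin 8) (b : Bool) : orbitRep i b 5 = b := rfl
    ext i <;> simp [h5, orbitIndex_orbitRep]


/-- For the permutation `σ` of `Fin 6` given by the 5-cycle `(0 1 2 3 4)` fixing `5`, the number of monotone functions `f : (Fin 6 → Bool) → Bool` with `f (x ∘ σ) = f x` for all `x` equals 64.  In the paper's notation: `|Fix((12345), D_6)| = 64`. -/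
theorem fix_card_12345_D6 (σ : Equiv.Perm (Fin 6))
    (h0 : σ 0 = 1) (h1 : σ 1 = 2) (h2 : σ 2 = 3) (h3 : σ 3 = 4) (h4 : σ 4 = 0) (h5 : σ 5 = 5) :
    Nat.card {f : (Fin 6 → Bool) → Bool //
        Monotone f ∧ ∀ x : Fin 6 → Bool, f (x ∘ ⇑σ) = f x} = 64 := by
  have hσ : ⇑σ = rot := by
    funext i
    fin_cases i <;> assumption
  rw [hσ, Nat.card_congr fixEquiv, Nat.card_eq_fintype_card, card_orbitMonotone_pairs]
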